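/- Let G be a minimal counterexample, with non-inner class-preserving Coleman automorphism φ of 2-power order. Then every proper normal subgroup N of G (N ≠ G) has even index [G : N]; equivalently, no proper normal subgroup of G contains a Sylow 2-subgroup of G. -/

import Mathlib

/-- A finite 2-group of order `2^n` (`n ≥ 4`) is semidihedral if it is generated by
elements `a`, `b` with `a^(2^(n-1)) = 1`, `b^2 = 1` and `b⁻¹ * a * b = a^(2^(n-2) - 1)`. -/
def IsSemidihedral (S : Type*) [Group S] : Prop :=
  ∃ n : ℕ, 4 ≤ n ∧ Nat.card S = 2 ^ n ∧ ∃ a b : S,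
    a ^ (2 ^ (n - 1)) = 1 ∧ b ^ 2 = 1 ∧ b⁻¹ * a * b = a ^ (2 ^ (n - 2) - 1) ∧
    Subgroup.closure {a, b} = ⊤

/-- An automorphism is class-preserving if it maps every element to a conjugate of itself. -/
def IsClassPres {G : Type*} [Group G] (φ : MulAut G) : Prop :=
  ∀ g : G, IsConj g (φ g)

/-- An automorphism is Coleman if its restriction to every Sylow subgroup is given by
conjugation by some element of the group. -/
def IsColemanAut {G : Type*} [Group G] (φ : MulAut G) : Prop :=
  ∀ p : ℕ, p.Prime → ∀ P : Sylow p G, ∃ x : G, ∀ u ∈ (P : Subgroup G), φ u = x⁻¹ * u * x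

/-- An automorphism is inner if it is conjugation by some group element. -/
def IsInnerAut {G : Type*} [Group G] (φ : MulAut G) : Prop :=
  ∃ g : G, φ = MulAut.conj g

universe u

/-- `G`, with automorphism `φ`, is a minimal counterexample: `G` is a finite group with
semidihedral Sylow 2-subgroups, `φ` is a non-inner class-preserving Coleman automorphism
of `G` of 2-power order, and every finite group of smaller order with semidihedral Sylow
2-subgroups admits no non-inner class-preserving Coleman automorphism of 2-power order. -/
def IsMinimalCounterexample (G : Type u) [Group G] [Finite G] (φ : MulAut G) : Prop :=
  (∀ S : Sylow 2 G, IsSemidihedral (S : Subgroup G)) ∧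
  ¬ IsInnerAut φ ∧ (∃ k : ℕ, orderOf φ = 2 ^ k) ∧ IsClassPres φ ∧ IsColemanAut φ ∧
  ∀ (H : Type u) [Group H] [Finite H], Nat.card H < Nat.card G →
    (∀ S : Sylow 2 H, IsSemidihedral (S : Subgroup H)) →
    ∀ ψ : MulAut H, (∃ k : ℕ, orderOf ψ = 2 ^ k) → IsClassPres ψ → IsColemanAut ψ →
      IsInnerAut ψ

/-- In a finite group, a subgroup meeting every conjugacy class is the whole group. -/
theorem Subgroup.eq_top_of_forall_exists_conj_mem {G : Type*} [Group G] [Finite G]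
    (H : Subgroup G) (h : ∀ g : G, ∃ x : G, x * g * x⁻¹ ∈ H) : H = ⊤ := by
  classical
  have := Fintype.ofFinite G
  have := Fintype.ofFinite (G ⧸ H)
  have hfix (g : G) : 1 ≤ Fintype.card (MulAction.fixedBy (G ⧸ H) g) := by
    obtain ⟨x, hx⟩ := h g
    refine Fintype.card_pos_iff.2 ⟨⟨((x⁻¹ : G) : G ⧸ H), ?_⟩⟩
    rw [MulAction.mem_fixedBy, MulAction.Quotient.smul_coe, eq_comm, QuotientGroup.eq]
    simpa [mul_assoc] using hx
  have hone : Fintype.card (MulAction.fixedBy (G ⧸ H) (1 : G)) = H.index := by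
    rw [← Nat.card_eq_fintype_card, MulAction.fixedBy_one_eq_univ, Nat.card_univ]
    rfl
  have hsum := MulAction.sum_card_fixedBy_eq_card_orbits_mul_card_group G (G ⧸ H)
  have horb : Fintype.card (MulAction.orbitRel.Quotient G (G ⧸ H)) = 1 := by
    rw [Fintype.card_eq_one_iff_nonempty_unique]
    exact (MulAction.pretransitive_iff_unique_quotient_of_nonempty G (G ⧸ H)).1 inferInstance
  rw [horb, one_mul, ← Finset.add_sum_erase _ _ (Finset.mem_univ (1 : G)), hone] at hsum
  have hle := Finset.card_nsmul_le_sum (Finset.univ.erase (1 : G)) _ 1 fun g _ ↦ hfix g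
  rw [smul_eq_mul, mul_one, Finset.card_erase_of_mem (Finset.mem_univ _), Finset.card_univ] at hle
  have hpos : 0 < Fintype.card G := Fintype.card_pos
  have hidx : H.index ≠ 0 := Subgroup.index_ne_zero_of_finite
  exact Subgroup.index_eq_one.1 (by omega)

/-- Powers of a class-preserving automorphism are class-preserving. -/
theorem IsClassPres.pow {G : Type*} [Group G] {ψ : MulAut G} (hψ : IsClassPres ψ) (j : ℕ) :
    IsClassPres (ψ ^ j) := by
  intro g
  induction j with
  | zero => exact IsConj.refl g
  | succ j ih =>
    rw [pow_succ', MulAut.mul_apply]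
    exact ih.trans (hψ _)

/-- In a finite group of order prime to `p`, a class-preserving automorphism of `p`-power order
is trivial. -/
theorem IsClassPres.eq_one_of_not_dvd_card {G : Type*} [Group G] [Finite G] {p : ℕ}
    [Fact p.Prime] (hG : ¬ p ∣ Nat.card G) {ψ : MulAut G} (hψ : IsClassPres ψ) {k : ℕ}
    (hk : ψ ^ p ^ k = 1) : ψ = 1 := by
  let H : Subgroup G := (ψ : G →* G).eqLocus (MonoidHom.id G)
  suffices H = ⊤ by
    ext g
    exact (this ▸ Subgroup.mem_top g : g ∈ H)
  refine H.eq_top_of_forall_exists_conj_mem fun g ↦ ?_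
  let C : SubMulAction (Subgroup.zpowers ψ) G :=
    { carrier := MulAction.orbit (ConjAct G) g
      smul_mem' := by
        rintro ⟨_, hτ⟩ x hx
        obtain ⟨j, rfl⟩ := (isOfFinOrder_of_finite ψ).mem_powers_iff_mem_zpowers.2 hτ
        rw [ConjAct.mem_orbit_conjAct] at hx ⊢
        exact ((hψ.pow j) x).symm.trans hx }
  have hP : IsPGroup p (Subgroup.zpowers ψ) := by
    obtain ⟨l, -, hl⟩ := (Nat.dvd_prime_pow Fact.out).1 (orderOf_dvd_of_pow_eq_one hk)
    exact IsPGroup.of_card (n := l) (by rw [Nat.card_zpowers, hl])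
  have hC : ¬ p ∣ Nat.card C := fun h ↦ hG <| by
    have := MulAction.index_stabilizer (ConjAct G) g
    refine (h.trans ?_).trans (MulAction.stabilizer (ConjAct G) g).index_dvd_card
    rw [this, ← Nat.card_coe_set_eq]
    rfl
  obtain ⟨⟨x, hx⟩, hfix⟩ := hP.nonempty_fixed_point_of_prime_not_dvd_card C hC
  obtain ⟨c, hc⟩ := isConj_iff.1 (ConjAct.mem_orbit_conjAct.1 hx).symm
  refine ⟨c, ?_⟩
  rw [hc]
  exact congrArg Subtype.val (hfix ⟨ψ, Subgroup.mem_zpowers ψ⟩)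

/-- A class-preserving automorphism stabilizes every normal subgroup. -/
theorem IsClassPres.map_eq {G : Type*} [Group G] [Finite G] {φ : MulAut G} (hφ : IsClassPres φ)
    (N : Subgroup G) [hN : N.Normal] : N.map (φ : G →* G) = N := by
  refine Subgroup.eq_of_le_of_card_ge ?_ (Nat.card_congr (φ.subgroupMap N).toEquiv).le
  rintro _ ⟨n, hn, rfl⟩
  obtain ⟨c, hc⟩ := isConj_iff.1 (hφ n)
  exact hc ▸ hN.conj_mem n hn c

/-- A class-preserving automorphism of `p`-power order acts trivially on every quotient of order
prime to `p`. -/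
theorem IsClassPres.map_mul_inv_mem {G : Type*} [Group G] [Finite G] {p : ℕ} [Fact p.Prime]
    {φ : MulAut G} (hφ : IsClassPres φ) {k : ℕ} (hk : φ ^ p ^ k = 1) {N : Subgroup G}
    [hN : N.Normal] (hp : ¬ p ∣ N.index) (g : G) : φ g * g⁻¹ ∈ N := by
  let ψ : MulAut (G ⧸ N) := QuotientGroup.congr N N φ (hφ.map_eq N)
  have hpow (j : ℕ) (x : G) : (ψ ^ j) (x : G ⧸ N) = ((φ ^ j) x : G) := by
    induction j with
    | zero => rfl
    | succ j ih =>
      rw [pow_succ', pow_succ', MulAut.mul_apply, MulAut.mul_apply, ih]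
      rfl
  have hψ : IsClassPres ψ := fun q ↦ by
    obtain ⟨x, rfl⟩ := QuotientGroup.mk_surjective q
    exact (QuotientGroup.mk' N).map_isConj (hφ x)
  have hone : ψ = 1 := hψ.eq_one_of_not_dvd_card hp (k := k) <| by
    ext q
    obtain ⟨x, rfl⟩ := QuotientGroup.mk_surjective q
    rw [hpow, hk]
    rfl
  have h : ((φ g : G) : G ⧸ N) = g := congrArg (fun τ : MulAut (G ⧸ N) ↦ τ (g : G ⧸ N)) hone
  rw [← div_eq_mul_inv, ← QuotientGroup.eq_iff_div_mem, h]

/-- Powers of the product of an inner automorphism and an automorphism acting trivially on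
`G ⧸ N`. -/
theorem MulAut.exists_conj_mul_pow {G : Type*} [Group G] {φ : MulAut G} {N : Subgroup G}
    [hN : N.Normal] (hφ : ∀ g, φ g * g⁻¹ ∈ N) (x : G) (m : ℕ) :
    ∃ z : G, (z : G ⧸ N) = (x : G ⧸ N) ^ m ∧
      (MulAut.conj x * φ) ^ m = MulAut.conj z * φ ^ m := by
  induction m with
  | zero => exact ⟨1, by simp⟩
  | succ m ih =>
    obtain ⟨z, hz, h⟩ := ih
    refine ⟨x * φ z, ?_, ?_⟩
    · have : ((φ z : G) : G ⧸ N) = z := by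
        rw [QuotientGroup.eq_iff_div_mem, div_eq_mul_inv]
        exact hφ z
      rw [QuotientGroup.mk_mul, this, hz, pow_succ']
    · rw [pow_succ', h]
      ext g
      simp [pow_succ', mul_assoc]

/-- If `n` is prime to the order of `a`, then some multiple of `n` is an exponent fixing `a`. -/
theorem exists_dvd_pow_eq_self {M : Type*} [Monoid M] {a : M} {n : ℕ}
    (h : n.Coprime (orderOf a)) : ∃ m, n ∣ m ∧ a ^ m = a := by
  obtain ⟨m, h0, h1⟩ := Nat.chineseRemainder h 0 1
  exact ⟨m, Nat.modEq_zero_iff_dvd.1 h0,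
    (pow_eq_pow_of_modEq h1 (pow_orderOf_eq_one a)).trans (pow_one a)⟩

/-- An automorphism `φ` acting trivially on `G ⧸ N`, of order prime to the index of `N`, that is
given on a set by conjugation by an element of `G` is given there by conjugation by an element
of `N`. -/
theorem MulAut.exists_mem_forall_eq_conj {G : Type*} [Group G] {φ : MulAut G} {N : Subgroup G}
    [hN : N.Normal] (hφ : ∀ g, φ g * g⁻¹ ∈ N) (hcop : N.index.Coprime (orderOf φ)) {U : Set G}
    {x : G} (hU : ∀ u ∈ U, φ u = x⁻¹ * u * x) : ∃ n ∈ N, ∀ u ∈ U, φ u = n⁻¹ * u * n := by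
  obtain ⟨m, hm, hφm⟩ := exists_dvd_pow_eq_self hcop
  obtain ⟨z, hz, hpow⟩ := MulAut.exists_conj_mul_pow hφ x m
  refine ⟨z, ?_, fun u hu ↦ ?_⟩
  · obtain ⟨l, rfl⟩ := hm
    rw [← QuotientGroup.eq_one_iff, hz, pow_mul]
    have : (x : G ⧸ N) ^ N.index = 1 := pow_card_eq_one'
    rw [this, one_pow]
  · have hfix : (MulAut.conj x * φ) u = u := by simp [hU u hu, mul_assoc]
    have hfixm : ((MulAut.conj x * φ) ^ m) u = u := by
      clear hpow hφm hm hz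
      induction m with
      | zero => rfl
      | succ m ih => rw [pow_succ, MulAut.mul_apply, hfix, ih]
    rw [hpow, hφm, MulAut.mul_apply, MulAut.conj_apply] at hfixm
    rw [eq_comm, ← hfixm]
    group
    simp [hfixm]

/-- If `σ` acts trivially on `N` and on `G ⧸ N`, then its power by the index of `N` is inner. -/
theorem MulAut.exists_pow_index_eq_conj {G : Type*} [Group G] [Finite G] {σ : MulAut G}
    {N : Subgroup G} [hN : N.Normal] (hσN : ∀ n ∈ N, σ n = n) (hσ : ∀ g, σ g * g⁻¹ ∈ N) :
    ∃ z : G, σ ^ N.index = MulAut.conj z := by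
  classical
  have := Fintype.ofFinite (G ⧸ N)
  let K : Subgroup G := (Subgroup.center N).map N.subtype
  have hK : K.Normal := inferInstance
  have hKN : K ≤ N := Subgroup.map_subtype_le _
  let _ : CommGroup K :=
    { (inferInstance : Group K) with
      mul_comm := by
        rintro ⟨_, x, hx, rfl⟩ ⟨_, y, hy, rfl⟩
        exact Subtype.ext (congrArg (Subtype.val : N → G) (Subgroup.mem_center_iff.1 hy x)) }
  have hcK (g : G) : σ g * g⁻¹ ∈ K := by
    refine ⟨⟨_, hσ g⟩, Subgroup.mem_center_iff.2 ?_, rfl⟩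
    rintro ⟨n, hn⟩
    ext
    have h1 := hσN _ (hN.conj_mem n hn g⁻¹)
    rw [map_mul, map_mul, hσN n hn, inv_inv, map_inv] at h1
    have h2 : n = σ g * (g⁻¹ * n * g) * (σ g)⁻¹ := by rw [← h1]; group
    change n * (σ g * g⁻¹) = σ g * g⁻¹ * n
    nth_rewrite 1 [h2]
    group
  let c (g : G) : K := ⟨σ g * g⁻¹, hcK g⟩
  have hcmul (g h : G) : c (g * h) = c g * MulAut.conjNormal g (c h) := by
    ext
    simp [c, mul_assoc]
  have hcN (g n : G) (hn : n ∈ N) : c (g * n) = c g := by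
    ext
    simp [c, hσN n hn]
  let d : G ⧸ N → K := Quotient.lift c fun a b hab ↦ by
    rw [← hcN a (a⁻¹ * b) (QuotientGroup.leftRel_apply.1 hab), mul_inv_cancel_left]
  let z : K := ∏ q, d q
  have hz (g : G) : z = c g ^ N.index * MulAut.conjNormal g z := by
    have hd (q : G ⧸ N) : d ((g : G ⧸ N) * q) = c g * MulAut.conjNormal g (d q) := by
      obtain ⟨x, rfl⟩ := QuotientGroup.mk_surjective q
      exact hcmul g x
    calc z = ∏ q, d ((g : G ⧸ N) * q) := (Equiv.prod_comp (Equiv.mulLeft (g : G ⧸ N)) d).symm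
      _ = _ := by
        simp_rw [hd, Finset.prod_mul_distrib, Finset.prod_const, Finset.card_univ,
          ← Nat.card_eq_fintype_card, z, map_prod]
        rfl
  have hpow (g : G) (j : ℕ) : (σ ^ j) g = (c g : G) ^ j * g := by
    induction j with
    | zero => simp
    | succ j ih =>
      rw [pow_succ', MulAut.mul_apply, ih, map_mul, map_pow, hσN _ (hKN (c g).2), pow_succ]
      simp [c, mul_assoc]
  refine ⟨z, MulEquiv.ext fun g ↦ ?_⟩
  have h := congrArg Subtype.val (hz g)
  rw [Subgroup.coe_mul, Subgroup.coe_pow, MulAut.conjNormal_apply] at h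
  rw [hpow, MulAut.conj_apply]
  nth_rewrite 1 [h]
  group

/-- A Sylow `p`-subgroup is contained in every normal subgroup of index prime to `p`. -/
theorem Sylow.le_of_not_dvd_index {G : Type*} [Group G] [Finite G] {p : ℕ} [Fact p.Prime]
    (S : Sylow p G) {N : Subgroup G} [N.Normal] (hp : ¬ p ∣ N.index) :
    (S : Subgroup G) ≤ N := by
  intro s hs
  obtain ⟨j, hj⟩ := S.isPGroup' ⟨s, hs⟩
  rw [← QuotientGroup.eq_one_iff, ← orderOf_eq_one_iff]
  have h1 : orderOf (s : G ⧸ N) ∣ p ^ j := orderOf_dvd_of_pow_eq_one <| by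
    rw [← QuotientGroup.mk_pow, show s ^ p ^ j = 1 from congrArg Subtype.val hj]
    rfl
  have h2 : orderOf (s : G ⧸ N) ∣ N.index := orderOf_dvd_natCard _
  exact Nat.eq_one_of_dvd_coprimes
    (((Fact.out : p.Prime).coprime_iff_not_dvd.2 hp).pow_left j) h1 h2

/-- Being semidihedral is invariant under isomorphism. -/
theorem IsSemidihedral.of_mulEquiv {S T : Type*} [Group S] [Group T] (e : S ≃* T)
    (h : IsSemidihedral S) : IsSemidihedral T := by
  obtain ⟨n, hn, hcard, a, b, ha, hb, hab, hgen⟩ := h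
  refine ⟨n, hn, (Nat.card_congr e.toEquiv).symm.trans hcard, e a, e b, ?_, ?_, ?_, ?_⟩
  · rw [← map_pow, ha, map_one]
  · rw [← map_pow, hb, map_one]
  · rw [← map_inv, ← map_mul, ← map_mul, hab, map_pow]
  · have := congrArg (Subgroup.map (e : S →* T)) hgen
    rw [MonoidHom.map_closure, Set.image_pair,
      Subgroup.map_top_of_surjective _ e.surjective] at this
    exact this

/-- In a minimal counterexample, every proper normal subgroup has even index. -/
theorem stmt_12 (G : Type u) [Group G] [Finite G] (φ : MulAut G)
    (hmin : IsMinimalCounterexample G φ) :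
    ∀ N : Subgroup G, N.Normal → N ≠ ⊤ → 2 ∣ N.index := by
  obtain ⟨hS, hinn, ⟨k, hk⟩, hcl, hcol, hmin⟩ := hmin
  intro N hN hne
  by_contra hodd
  have hφk : φ ^ 2 ^ k = 1 := hk ▸ pow_orderOf_eq_one φ
  have htriv : ∀ g, φ g * g⁻¹ ∈ N := hcl.map_mul_inv_mem hφk hodd
  have hcop : N.index.Coprime (orderOf φ) :=
    hk ▸ ((Nat.prime_two.coprime_iff_not_dvd.2 hodd).pow_left k).symm
  let ψ : MulAut N := (φ.subgroupMap N).trans (MulEquiv.subgroupCongr (hcl.map_eq N))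
  have hψ (n : N) : ((ψ n : N) : G) = φ n := rfl
  have hψpow (j : ℕ) (n : N) : (((ψ ^ j) n : N) : G) = (φ ^ j) n := by
    induction j with
    | zero => rfl
    | succ j ih => rw [pow_succ', pow_succ', MulAut.mul_apply, MulAut.mul_apply, hψ, ih]
  have hcard : Nat.card N < Nat.card G :=
    lt_of_le_of_ne N.card_le_card_group fun h ↦ hne (N.eq_top_of_card_eq h)
  have hsyl (P : Sylow 2 N) : IsSemidihedral (P : Subgroup N) := by
    obtain ⟨S⟩ : Nonempty (Sylow 2 G) := inferInstance
    have hSN := S.le_of_not_dvd_index hodd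
    exact (hS S).of_mulEquiv
      ((Subgroup.subgroupOfEquivOfLe hSN).symm.trans ((S.subtype hSN).equiv P))
  have hψk : ∃ l : ℕ, orderOf ψ = 2 ^ l := by
    obtain ⟨l, -, hl⟩ := (Nat.dvd_prime_pow Nat.prime_two).1 <|
      orderOf_dvd_of_pow_eq_one (x := ψ) (n := 2 ^ k) <| by
        ext n
        rw [hψpow, hφk]
        rfl
    exact ⟨l, hl⟩
  have hψcl : IsClassPres ψ := fun n ↦ by
    obtain ⟨x, hx⟩ := isConj_iff.1 (hcl n)
    obtain ⟨y, hy, hyn⟩ := MulAut.exists_mem_forall_eq_conj htriv hcop (U := {(n : G)}) (x := x⁻¹)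
      (by simp [← hx])
    refine isConj_iff.2 ⟨⟨y, hy⟩⁻¹, Subtype.ext ?_⟩
    simp [hψ, hyn]
  have hψcol : IsColemanAut ψ := fun p hp P ↦ by
    obtain ⟨Q, hQ⟩ := (P.isPGroup'.map N.subtype).exists_le_sylow
    obtain ⟨x, hx⟩ := hcol p hp Q
    obtain ⟨y, hy, hyn⟩ := MulAut.exists_mem_forall_eq_conj htriv hcop hx
    exact ⟨⟨y, hy⟩, fun u hu ↦ Subtype.ext <|
      hyn u (hQ (Subgroup.mem_map_of_mem N.subtype hu))⟩
  obtain ⟨n, hn⟩ := hmin N hcard hsyl ψ hψk hψcl hψcol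
  let σ : MulAut G := MulAut.conj (n : G)⁻¹ * φ
  have hσN : ∀ u ∈ N, σ u = u := fun u hu ↦ by
    have h : φ u = n * u * (n : G)⁻¹ :=
      congrArg Subtype.val (DFunLike.congr_fun hn (⟨u, hu⟩ : N))
    simp [σ, h, mul_assoc]
  have hσ : ∀ g, σ g * g⁻¹ ∈ N := fun g ↦ by
    have h := N.mul_mem (N.mul_mem (N.inv_mem n.2) (htriv g)) (hN.conj_mem n n.2 g)
    simpa [σ, mul_assoc] using h
  obtain ⟨z, hz⟩ := MulAut.exists_pow_index_eq_conj hσN hσ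
  obtain ⟨m, ⟨l, rfl⟩, hm⟩ := exists_dvd_pow_eq_self hcop
  obtain ⟨y, -, hy⟩ := MulAut.exists_conj_mul_pow htriv (n : G)⁻¹ (N.index * l)
  refine hinn ⟨y⁻¹ * z ^ l, ?_⟩
  rw [map_mul, map_inv, map_pow, ← hz, ← pow_mul, eq_inv_mul_iff_mul_eq]
  rw [hm] at hy
  exact hy.symm
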